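/- arXiv:0910.0845 — 3 statements merged into one kernel-verified Lean document; each statement's English description precedes it below -/
import Mathlib

section
/- Fix j ∈ {1, …, p}, let y_1, …, y_p > 0, and let w ∈ Δ_p with w_j < 1. Set m = min_{k ≠ j, w_k > 0} y_k/w_k, Z = m/(y_j/(1−w_j) + m), and ξ = min_{k : w_k > 0} y_k/w_k. Then ∫_0^{1−w_j} (1{Z ≤ z} − z)/(z(1−z)) dz = log[1 − ((1−w_j) ∧ Z)] + log(1−w_j) − log((1−w_j) ∧ Z) = log y_j − log ξ, where ∧ denotes minimum. -/
open MeasureTheory Filter Real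

noncomputable section

/-- The unit simplex `Δ_p = {w ∈ [0,1]^p : w_1 + ⋯ + w_p = 1}`. -/
def simplex (p : ℕ) : Set (Fin p → ℝ) :=
  {w | (∀ j, 0 ≤ w j ∧ w j ≤ 1) ∧ ∑ j, w j = 1}

/-- Minimum of `f` over a finset `s` (with junk value `0` if `s` is empty). -/
noncomputable def minOver {p : ℕ} (s : Finset (Fin p)) (f : Fin p → ℝ) : ℝ :=
  if h : s.Nonempty then s.inf' h f else 0

lemma integral_indicator_sub_div {a Z : ℝ} (ha : 0 < a) (ha1 : a ≤ 1) (hZ : 0 < Z) (hZ1 : Z < 1) :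
    ∫ z in (0:ℝ)..a, ((if Z ≤ z then (1:ℝ) else 0) - z) / (z * (1 - z))
      = Real.log (1 - min a Z) + Real.log a - Real.log (min a Z) := by
  set c := min a Z with hc
  have hc0 : 0 < c := lt_min ha hZ
  have hca : c ≤ a := min_le_left _ _
  have hcZ : c ≤ Z := min_le_right _ _
  have hc1 : c < 1 := hcZ.trans_lt hZ1
  have below : Set.EqOn (fun z : ℝ => -(1 - z)⁻¹)
      (fun z => ((if Z ≤ z then (1:ℝ) else 0) - z) / (z * (1 - z))) (Set.Ioo 0 c) := by
    intro z hz
    have h0 : z ≠ 0 := hz.1.ne'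
    have h1 : 1 - z ≠ 0 := by linarith [hz.2]
    simp only [if_neg (not_le.2 (hz.2.trans_le hcZ))]
    field_simp
    ring
  have above : Set.EqOn (fun z : ℝ => z⁻¹)
      (fun z => ((if Z ≤ z then (1:ℝ) else 0) - z) / (z * (1 - z))) (Set.Ioo c a) := by
    intro z hz
    have h0 : z ≠ 0 := (hc0.trans hz.1).ne'
    have h1 : 1 - z ≠ 0 := by linarith [hz.2]
    have hZz : Z ≤ z := by
      rcases min_lt_iff.1 hz.1 with h | h
      · exact absurd hz.2 (not_lt.2 h.le)
      · exact h.le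
    simp only [if_pos hZz]
    field_simp
  have int_below : IntervalIntegrable (fun z : ℝ => -(1 - z)⁻¹) volume 0 c := by
    apply ContinuousOn.intervalIntegrable
    rw [Set.uIcc_of_le hc0.le]
    refine ((continuousOn_const.sub continuousOn_id).inv₀ fun z hz => ?_).neg
    exact (sub_pos.2 (hz.2.trans_lt hc1)).ne'
  have int_above : IntervalIntegrable (fun z : ℝ => z⁻¹) volume c a := by
    apply ContinuousOn.intervalIntegrable
    rw [Set.uIcc_of_le hca]
    exact continuousOn_id.inv₀ fun z hz => (hc0.trans_le hz.1).ne'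
  have val_below : ∫ z in (0:ℝ)..c, -(1 - z)⁻¹ = Real.log (1 - c) := by
    rw [intervalIntegral.integral_eq_sub_of_hasDerivAt (f := fun z => Real.log (1 - z)) ?_ int_below]
    · simp
    · intro z hz
      rw [Set.uIcc_of_le hc0.le] at hz
      have h1 : 1 - z ≠ 0 := by linarith [hz.2]
      simpa [neg_div] using ((hasDerivAt_id z).const_sub 1).log h1
  have val_above : ∫ z in c..a, z⁻¹ = Real.log a - Real.log c := by
    rw [integral_inv_of_pos hc0 ha, Real.log_div ha.ne' hc0.ne']
  have hb := int_below.congr_uIoo (by rwa [Set.uIoo_of_le hc0.le])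
  have hab := int_above.congr_uIoo (by rwa [Set.uIoo_of_le hca])
  rw [← intervalIntegral.integral_add_adjacent_intervals hb hab,
    ← intervalIntegral.integral_congr_Ioo_of_le hc0.le below,
    ← intervalIntegral.integral_congr_Ioo_of_le hca above, val_below, val_above]
  ring

lemma log_one_sub_min_eq {m v b : ℝ} (hm : 0 < m) (hv : 0 < v) (hb0 : 0 ≤ b) (hb : b < 1) :
    Real.log (1 - min (1 - b) (m / (v / (1 - b) + m))) + Real.log (1 - b)
        - Real.log (min (1 - b) (m / (v / (1 - b) + m)))
      = Real.log v - Real.log (if 0 < b then min m (v / b) else m) := by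
  have ha : 0 < 1 - b := by linarith
  have hd : 0 < v / (1 - b) + m := by positivity
  have key : m / (v / (1 - b) + m) ≤ 1 - b ↔ b * m ≤ v := by
    rw [div_le_iff₀ hd, mul_add, mul_div_cancel₀ _ ha.ne']
    constructor <;> intro h <;> linarith
  by_cases h : b * m ≤ v
  · have hξ : (if 0 < b then min m (v / b) else m) = m := by
      split_ifs with h0
      · exact min_eq_left ((le_div_iff₀ h0).2 (by linarith))
      · rfl
    have h1 : 1 - m / (v / (1 - b) + m) = v / (1 - b) / (v / (1 - b) + m) := by
      field_simp
      ring
    rw [hξ, min_eq_right (key.2 h), h1, Real.log_div (by positivity) hd.ne',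
      Real.log_div hv.ne' ha.ne', Real.log_div hm.ne' hd.ne']
    ring
  · have h0 : 0 < b := hb0.lt_of_ne fun h0 => h (by rw [← h0]; linarith)
    rw [min_eq_left (le_of_not_ge (mt key.1 h)), if_pos h0,
      min_eq_right ((div_le_iff₀ h0).2 (by linarith)), Real.log_div hv.ne' h0.ne', sub_sub_cancel]
    ring

lemma minOver_pos_weight_eq {p : ℕ} (j : Fin p) (f w : Fin p → ℝ)
    (hs : (Finset.univ.filter fun k => k ≠ j ∧ 0 < w k).Nonempty) :
    minOver (Finset.univ.filter fun k => 0 < w k) f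
      = if 0 < w j then min (minOver (Finset.univ.filter fun k => k ≠ j ∧ 0 < w k) f) (f j)
        else minOver (Finset.univ.filter fun k => k ≠ j ∧ 0 < w k) f := by
  split_ifs with hj
  · have hins : (Finset.univ.filter fun k => 0 < w k)
        = insert j (Finset.univ.filter fun k => k ≠ j ∧ 0 < w k) := by
      ext k
      by_cases hk : k = j <;> simp [hk, hj]
    rw [hins, minOver, minOver, dif_pos hs, dif_pos (Finset.insert_nonempty _ _),
      Finset.inf'_insert, min_comm]
  · congr 1
    ext k
    by_cases hk : k = j <;> simp [hk, hj]

lemma exists_ne_pos_of_mem_simplex {p : ℕ} {w : Fin p → ℝ} (hw : w ∈ simplex p) {j : Fin p}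
    (hj : w j < 1) : (Finset.univ.filter fun k => k ≠ j ∧ 0 < w k).Nonempty := by
  by_contra hne
  rw [Finset.not_nonempty_iff_eq_empty, Finset.filter_eq_empty_iff] at hne
  have hsum : ∑ k, w k = w j := Finset.sum_eq_single j
    (fun k hk hkj => le_antisymm (not_lt.1 fun h => hne hk ⟨hkj, h⟩) (hw.1 k).1) (by simp)
  linarith [hw.2]

/-- the key integral identity behind the equality of the ZWP- and
CFG-estimators.  With `m = min_{k ≠ j, w_k > 0} y_k / w_k`,
`Z = m / (y_j/(1−w_j) + m)` and `ξ = min_{k : w_k > 0} y_k / w_k`,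
`∫_0^{1−w_j} (1{Z ≤ z} − z)/(z(1−z)) dz
  = log(1 − ((1−w_j) ∧ Z)) + log(1−w_j) − log((1−w_j) ∧ Z) = log y_j − log ξ`. -/
theorem integral_identity
    {p : ℕ} (hp : 2 ≤ p) (j : Fin p)
    (y : Fin p → ℝ) (hy : ∀ k, 0 < y k)
    (w : Fin p → ℝ) (hw : w ∈ simplex p) (hwj : w j < 1) :
    (∫ z in (0:ℝ)..(1 - w j),
        ((if minOver (Finset.univ.filter fun k => k ≠ j ∧ 0 < w k)
              (fun k => y k / w k) /
            (y j / (1 - w j) +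
              minOver (Finset.univ.filter fun k => k ≠ j ∧ 0 < w k)
                (fun k => y k / w k)) ≤ z then (1:ℝ) else 0) - z) / (z * (1 - z)))
      = Real.log (1 - min (1 - w j)
            (minOver (Finset.univ.filter fun k => k ≠ j ∧ 0 < w k)
                (fun k => y k / w k) /
              (y j / (1 - w j) +
                minOver (Finset.univ.filter fun k => k ≠ j ∧ 0 < w k)
                  (fun k => y k / w k))))
          + Real.log (1 - w j)
          - Real.log (min (1 - w j)
              (minOver (Finset.univ.filter fun k => k ≠ j ∧ 0 < w k)
                  (fun k => y k / w k) /
                (y j / (1 - w j) +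
                  minOver (Finset.univ.filter fun k => k ≠ j ∧ 0 < w k)
                    (fun k => y k / w k)))) ∧
    Real.log (1 - min (1 - w j)
            (minOver (Finset.univ.filter fun k => k ≠ j ∧ 0 < w k)
                (fun k => y k / w k) /
              (y j / (1 - w j) +
                minOver (Finset.univ.filter fun k => k ≠ j ∧ 0 < w k)
                  (fun k => y k / w k))))
          + Real.log (1 - w j)
          - Real.log (min (1 - w j)
              (minOver (Finset.univ.filter fun k => k ≠ j ∧ 0 < w k)
                  (fun k => y k / w k) /
                (y j / (1 - w j) +
                  minOver (Finset.univ.filter fun k => k ≠ j ∧ 0 < w k)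
                    (fun k => y k / w k))))
      = Real.log (y j)
          - Real.log (minOver (Finset.univ.filter fun k => 0 < w k)
              (fun k => y k / w k)) := by
  have hs := exists_ne_pos_of_mem_simplex hw hwj
  rw [minOver_pos_weight_eq j _ w hs]
  have hm : 0 < minOver (Finset.univ.filter fun k => k ≠ j ∧ 0 < w k) (fun k => y k / w k) := by
    rw [minOver, dif_pos hs, Finset.lt_inf'_iff]
    intro k hk
    exact div_pos (hy k) (Finset.mem_filter.1 hk).2.2
  generalize minOver (Finset.univ.filter fun k => k ≠ j ∧ 0 < w k) (fun k => y k / w k) = m at hm ⊢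
  have ha : 0 < 1 - w j := sub_pos.2 hwj
  have hv : 0 < y j / (1 - w j) := div_pos (hy j) ha
  have hd : 0 < y j / (1 - w j) + m := add_pos hv hm
  have hZ1 : m / (y j / (1 - w j) + m) < 1 := (div_lt_one hd).2 (by linarith)
  exact ⟨integral_indicator_sub_div ha (by linarith [(hw.1 j).1]) (div_pos hm hd) hZ1,
    log_one_sub_min_eq hm (hy j) (hw.1 j).1 hwj⟩
end
end

section
/- Let Y_{ij} > 0 for i ∈ {1, …, n} and j ∈ {1, …, p}, let γ be the Euler–Mascheroni constant, and for w ∈ Δ_p set ξ_i(w) = min_{j : w_j > 0} Y_{ij}/w_j. Let λ_1, …, λ_p : Δ_p → ℝ satisfy λ_1(w) + ⋯ + λ_p(w) = 1 for all w ∈ Δ_p. Define log Â_n(w) = −(1/n) Σ_{i=1}^n log ξ_i(w) − γ, log Â_n^CFG(w) = log Â_n(w) − Σ_{j=1}^p λ_j(w) log Â_n(e_j), and, for w with max_j w_j < 1, log Â_n^ZWP(w) = Σ_{j=1}^p λ_j(w) ∫_0^{1−w_j} [n^{−1} Σ_{i=1}^n 1{Z_{ij}(w) ≤ z} − z]/(z(1−z))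 dz, where Z_{ij}(w) = m_{ij}(w)/(Y_{ij}/(1−w_j) + m_{ij}(w)) and m_{ij}(w) = min_{k ≠ j, w_k > 0} Y_{ik}/w_k. Then Â_n^ZWP(w) = Â_n^CFG(w) for every w ∈ Δ_p with max_j w_j < 1. -/
open MeasureTheory Filter Real

noncomputable section

/-- The standard unit vector `e_j` of `ℝ^p`. -/
def unitVec {p : ℕ} (j : Fin p) : Fin p → ℝ := fun k => if k = j then 1 else 0

/-- `ξ_i(w) = min_{j : w_j > 0} Y_{ij} / w_j`. -/
noncomputable def xi {p : ℕ} (w y : Fin p → ℝ) : ℝ :=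
  minOver (Finset.univ.filter fun j => 0 < w j) (fun j => y j / w j)

/-- `m_{ij}(w) = min_{k ≠ j, w_k > 0} Y_{ik} / w_k`. -/
noncomputable def mm {p : ℕ} (j : Fin p) (w y : Fin p → ℝ) : ℝ :=
  minOver (Finset.univ.filter fun k => k ≠ j ∧ 0 < w k) (fun k => y k / w k)

/-- `Z_{ij}(w) = m_{ij}(w) / (Y_{ij}/(1−w_j) + m_{ij}(w))`. -/
noncomputable def ZZ {p : ℕ} (j : Fin p) (w y : Fin p → ℝ) : ℝ :=
  mm j w y / (y j / (1 - w j) + mm j w y)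

/-- The naive estimator on the log scale:
`log Â_n(w) = −(1/n) Σ_{i=1}^n log ξ_i(w) − γ`. -/
noncomputable def logAhat {n p : ℕ} (Y : Fin n → Fin p → ℝ) (w : Fin p → ℝ) : ℝ :=
  -(1 / (n : ℝ)) * ∑ i, Real.log (xi w (Y i)) - Real.eulerMascheroniConstant

/-- The integrand `(1{Z ≤ z} - z) / (z (1 - z))` of the ZWP-estimator is integrable on `[0, b]`, and
its integral is elementary. -/
theorem intervalIntegrable_and_integral_indicator_sub_div {Z b : ℝ} (hZ0 : 0 < Z) (hZ1 : Z < 1)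
    (hb0 : 0 < b) (hb1 : b ≤ 1) :
    IntervalIntegrable (fun z : ℝ => ((if Z ≤ z then (1:ℝ) else 0) - z) / (z * (1 - z)))
        volume 0 b ∧
      ∫ z in (0:ℝ)..b, ((if Z ≤ z then (1:ℝ) else 0) - z) / (z * (1 - z)) =
        Real.log (1 - min Z b) + Real.log b - Real.log (min Z b) := by
  set c := min Z b with hc
  have hc0 : 0 < c := lt_min hZ0 hb0
  have hc1 : c < 1 := (min_le_left _ _).trans_lt hZ1
  have hcb : c ≤ b := min_le_right _ _
  have hleft : Set.EqOn (fun z : ℝ => -(1 - z)⁻¹)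
      (fun z : ℝ => ((if Z ≤ z then (1:ℝ) else 0) - z) / (z * (1 - z))) (Set.Ioo 0 c) := by
    intro z ⟨hz0, hzc⟩
    have hzZ : ¬ Z ≤ z := not_le.2 (hzc.trans_le (min_le_left _ _))
    have h1 : 1 - z ≠ 0 := by linarith
    have h0 : z ≠ 0 := hz0.ne'
    simp only [hzZ, if_false]
    field_simp
    ring
  have hright : Set.EqOn (fun z : ℝ => z⁻¹)
      (fun z : ℝ => ((if Z ≤ z then (1:ℝ) else 0) - z) / (z * (1 - z))) (Set.Ioo c b) := by
    intro z ⟨hcz, hzb⟩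
    have hzZ : Z ≤ z := by
      rcases min_lt_iff.1 hcz with h | h
      · exact h.le
      · exact absurd h hzb.not_gt
    have h1 : 1 - z ≠ 0 := by linarith
    have h0 : z ≠ 0 := (hc0.trans hcz).ne'
    simp only [hzZ, if_true]
    field_simp
  have ileft := (intervalIntegral.intervalIntegrable_inv (μ := volume) (a := 0) (b := c)
    (f := fun z : ℝ => 1 - z)
    (fun z hz => by rw [Set.uIcc_of_le hc0.le] at hz; have := hz.2; linarith)
    (by fun_prop)).neg.congr_uIoo (by rw [Set.uIoo_of_le hc0.le]; exact hleft)
  have iright := (intervalIntegral.intervalIntegrable_inv (μ := volume) (a := c) (b := b)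
    (f := fun z : ℝ => z)
    (fun z hz => by rw [Set.uIcc_of_le hcb] at hz; exact (hc0.trans_le hz.1).ne')
    (by fun_prop)).congr_uIoo (by rw [Set.uIoo_of_le hcb]; exact hright)
  refine ⟨ileft.trans iright, ?_⟩
  rw [← intervalIntegral.integral_add_adjacent_intervals ileft iright,
    ← intervalIntegral.integral_congr_Ioo_of_le hc0.le hleft,
    ← intervalIntegral.integral_congr_Ioo_of_le hcb hright,
    intervalIntegral.integral_neg,
    intervalIntegral.integral_comp_sub_left (fun x : ℝ => x⁻¹) 1,
    integral_inv_of_pos (by linarith) (by norm_num), integral_inv_of_pos hc0 hb0,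
    Real.log_div (by norm_num) (by linarith), Real.log_div hb0.ne' hc0.ne']
  simp
  ring

theorem minOver_pos {p : ℕ} {s : Finset (Fin p)} (hs : s.Nonempty) {f : Fin p → ℝ}
    (hf : ∀ k ∈ s, 0 < f k) : 0 < minOver s f := by
  rw [minOver, dif_pos hs]
  exact (Finset.lt_inf'_iff hs).2 hf

theorem xi_unitVec {p : ℕ} (j : Fin p) (y : Fin p → ℝ) : xi (unitVec j) y = y j := by
  have hs : (Finset.univ.filter fun k => 0 < unitVec j k) = {j} := by
    ext k
    rw [Finset.mem_filter, Finset.mem_singleton, unitVec]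
    by_cases h : k = j <;> simp [h]
  rw [xi, hs, minOver, dif_pos (Finset.singleton_nonempty j), Finset.inf'_singleton, unitVec,
    if_pos rfl, div_one]

section WeightBelowOne

variable {p : ℕ} {w : Fin p → ℝ} {j : Fin p}

theorem exists_ne_weight_pos (hw : w ∈ simplex p) (hj : w j < 1) :
    (Finset.univ.filter fun k => k ≠ j ∧ 0 < w k).Nonempty := by
  by_contra h
  have h0 : ∀ k, k ≠ j → w k = 0 := by
    intro k hk
    by_contra hne
    exact h ⟨k, by simpa using ⟨hk, lt_of_le_of_ne (hw.1 k).1 (Ne.symm hne)⟩⟩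
  have := hw.2
  rw [Finset.sum_eq_single j (fun k _ hk => h0 k hk) (by simp)] at this
  linarith

theorem mm_pos (hw : w ∈ simplex p) (hj : w j < 1) {y : Fin p → ℝ} (hy : ∀ k, 0 < y k) :
    0 < mm j w y :=
  minOver_pos (exists_ne_weight_pos hw hj) fun k hk =>
    div_pos (hy k) (Finset.mem_filter.1 hk).2.2

theorem xi_eq_mm_of_weight_eq_zero (hj : w j = 0) (y : Fin p → ℝ) : xi w y = mm j w y := by
  have hs : (Finset.univ.filter fun k => 0 < w k) =
      Finset.univ.filter fun k => k ≠ j ∧ 0 < w k := by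
    ext k
    by_cases h : k = j <;> simp [h, hj]
  rw [xi, mm, hs]

theorem xi_eq_min_of_weight_pos (hw : w ∈ simplex p) (hj : w j < 1) (hj0 : 0 < w j)
    (y : Fin p → ℝ) : xi w y = min (y j / w j) (mm j w y) := by
  have hne := exists_ne_weight_pos hw hj
  have hs : (Finset.univ.filter fun k => 0 < w k) =
      insert j (Finset.univ.filter fun k => k ≠ j ∧ 0 < w k) := by
    ext k
    by_cases h : k = j <;> simp [h, hj0]
  rw [xi, hs, minOver, dif_pos (Finset.insert_nonempty _ _), Finset.inf'_insert, mm, minOver,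
    dif_pos hne]

theorem ZZ_mem_Ioo (hw : w ∈ simplex p) (hj : w j < 1) {y : Fin p → ℝ} (hy : ∀ k, 0 < y k) :
    ZZ j w y ∈ Set.Ioo (0 : ℝ) 1 := by
  have hm := mm_pos hw hj hy
  have hq : 0 < y j / (1 - w j) := div_pos (hy j) (by linarith)
  refine ⟨div_pos hm (by linarith), ?_⟩
  rw [ZZ, div_lt_one (by linarith)]
  linarith

theorem log_min_ZZ (hw : w ∈ simplex p) (hj : w j < 1) {y : Fin p → ℝ} (hy : ∀ k, 0 < y k) :
    Real.log (1 - min (ZZ j w y) (1 - w j)) + Real.log (1 - w j)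
        - Real.log (min (ZZ j w y) (1 - w j)) =
      Real.log (y j) - Real.log (xi w y) := by
  have hm := mm_pos hw hj hy
  have hyj := hy j
  have hb : 0 < 1 - w j := by linarith
  have hw0 : 0 ≤ w j := (hw.1 j).1
  have hD : 0 < y j + (1 - w j) * mm j w y := by positivity
  have hZ : ZZ j w y = (1 - w j) * mm j w y / (y j + (1 - w j) * mm j w y) := by
    rw [ZZ]
    field_simp
  have hle : ZZ j w y ≤ 1 - w j ↔ w j * mm j w y ≤ y j := by
    rw [hZ, div_le_iff₀ hD, mul_le_mul_iff_right₀ hb]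
    constructor <;> intro h <;> linarith
  by_cases h : w j * mm j w y ≤ y j
  · have hxi : xi w y = mm j w y := by
      rcases hw0.eq_or_lt with h0 | h0
      · exact xi_eq_mm_of_weight_eq_zero h0.symm y
      · rw [xi_eq_min_of_weight_pos hw hj h0, min_eq_right]
        rwa [le_div_iff₀ h0, mul_comm]
    have h1 : 1 - (1 - w j) * mm j w y / (y j + (1 - w j) * mm j w y) =
        y j / (y j + (1 - w j) * mm j w y) := by
      field_simp
      ring
    rw [min_eq_left (hle.2 h), hxi, hZ, h1, Real.log_div hyj.ne' hD.ne',
      Real.log_div (by positivity) hD.ne', Real.log_mul hb.ne' hm.ne']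
    ring
  · have h0 : 0 < w j := by
      rcases hw0.eq_or_lt with h0 | h0
      · rw [← h0] at h
        exact absurd (by linarith) h
      · exact h0
    have hxi : xi w y = y j / w j := by
      rw [xi_eq_min_of_weight_pos hw hj h0, min_eq_left]
      rw [div_le_iff₀ h0, mul_comm]
      exact (not_le.1 h).le
    rw [min_eq_right (le_of_not_ge fun h' => h (hle.1 h')), hxi, Real.log_div hyj.ne' h0.ne']
    simp

end WeightBelowOne

theorem integral_zwp_eq_sub_logAhat {p n : ℕ} (hn : 1 ≤ n) {Y : Fin n → Fin p → ℝ}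
    (hY : ∀ i j, 0 < Y i j) {w : Fin p → ℝ} (hw : w ∈ simplex p) {j : Fin p} (hj : w j < 1) :
    ∫ z in (0:ℝ)..(1 - w j),
        ((1 / (n : ℝ)) * ∑ i, (if ZZ j w (Y i) ≤ z then (1:ℝ) else 0) - z) / (z * (1 - z)) =
      logAhat Y w - logAhat Y (unitVec j) := by
  have hn0 : (n : ℝ) ≠ 0 := by positivity
  have hint i := intervalIntegrable_and_integral_indicator_sub_div
    (ZZ_mem_Ioo hw hj (hY i)).1 (ZZ_mem_Ioo hw hj (hY i)).2
    (by linarith : 0 < 1 - w j) (by linarith [(hw.1 j).1])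
  have hsum (z : ℝ) :
      ((1 / (n : ℝ)) * ∑ i, (if ZZ j w (Y i) ≤ z then (1:ℝ) else 0) - z) / (z * (1 - z)) =
        (1 / (n : ℝ)) *
          ∑ i, ((if ZZ j w (Y i) ≤ z then (1:ℝ) else 0) - z) / (z * (1 - z)) := by
    rw [← Finset.sum_div, Finset.sum_sub_distrib, Finset.sum_const, Finset.card_univ,
      Fintype.card_fin, nsmul_eq_mul, ← mul_div_assoc, mul_sub (1 / (n : ℝ)), ← mul_assoc (1 / (n : ℝ)) n z,
      one_div_mul_cancel hn0, one_mul]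
  simp only [hsum]
  rw [intervalIntegral.integral_const_mul,
    intervalIntegral.integral_finsetSum fun i _ => (hint i).1]
  simp only [(hint _).2, log_min_ZZ hw hj (hY _), logAhat, xi_unitVec, Finset.sum_sub_distrib]
  ring

/-- the ZWP-estimator coincides with the CFG-estimator whenever the
weight functions `λ_j` sum to one:  for every `w ∈ Δ_p` with `max_j w_j < 1`,
`Â_n^ZWP(w) = Â_n^CFG(w)`. -/
theorem zwp_eq_cfg
    {p n : ℕ} (hp : 2 ≤ p) (hn : 1 ≤ n)
    (Y : Fin n → Fin p → ℝ) (hY : ∀ i j, 0 < Y i j)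
    (lam : Fin p → (Fin p → ℝ) → ℝ)
    (hlam : ∀ w ∈ simplex p, ∑ j, lam j w = 1) :
    ∀ w ∈ simplex p, (∀ j, w j < 1) →
      Real.exp (∑ j, lam j w *
          ∫ z in (0:ℝ)..(1 - w j),
            ((1 / (n : ℝ)) * ∑ i, (if ZZ j w (Y i) ≤ z then (1:ℝ) else 0) - z) /
              (z * (1 - z)))
        = Real.exp (logAhat Y w - ∑ j, lam j w * logAhat Y (unitVec j)) := by
  intro w hw hw1
  congr 1
  simp only [integral_zwp_eq_sub_logAhat hn hY hw (hw1 _)]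
  simp only [mul_sub, Finset.sum_sub_distrib, ← Finset.sum_mul, hlam w hw, one_mul]
end
end

section
/- For every y ∈ (0,∞)^p and every w ∈ Δ_p, | log ( min_{j : w_j > 0} y_j/w_j ) | ≤ max{ | log ( min_{j} y_j ) | , log(p) + Σ_{j=1}^p | log y_j | }. -/
open Real

noncomputable section

/-- for `y ∈ (0,∞)^p` and `w ∈ Δ_p`,
`|log(min_{j : w_j > 0} y_j/w_j)| ≤ max{ |log(min_j y_j)|, log p + Σ_j |log y_j| }`. -/
theorem log_min_bound
    {p : ℕ} (hp : 1 ≤ p)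
    (y : Fin p → ℝ) (hy : ∀ j, 0 < y j)
    (w : Fin p → ℝ) (hw : w ∈ simplex p) :
    |Real.log (minOver (Finset.univ.filter fun j => 0 < w j) (fun j => y j / w j))|
      ≤ max |Real.log (minOver Finset.univ y)|
          (Real.log p + ∑ j, |Real.log (y j)|) := by
  have abs_log_le (k : Fin p) : |Real.log (y k)| ≤ ∑ j, |Real.log (y j)| :=
    Finset.single_le_sum (f := fun j => |Real.log (y j)|)
      (fun j _ => abs_nonneg _) (Finset.mem_univ k)
  have hp0 : (0 : ℝ) < p := by exact_mod_cast hp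
  have hlogp : 0 ≤ Real.log p := Real.log_natCast_nonneg p
  obtain ⟨k, hk⟩ : ∃ k, 1 / (p : ℝ) ≤ w k := by
    by_contra! h
    have : Nonempty (Fin p) := ⟨⟨0, hp⟩⟩
    have hlt := Finset.sum_lt_sum_of_nonempty Finset.univ_nonempty fun j _ => h j
    simp [hw.2, hp0.ne'] at hlt
  have hwk : 0 < w k := (one_div_pos.mpr hp0).trans_le hk
  have hne : (Finset.univ.filter fun j => 0 < w j).Nonempty := ⟨k, by simpa using hwk⟩
  rw [minOver, dif_pos hne]
  obtain ⟨i, hi, hmin⟩ := Finset.exists_mem_eq_inf' hne fun j => y j / w j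
  have hwi : 0 < w i := (Finset.mem_filter.mp hi).2
  have hle : y i / w i ≤ y k / w k :=
    hmin ▸ Finset.inf'_le _ (Finset.mem_filter.mpr ⟨Finset.mem_univ k, hwk⟩)
  rw [hmin]
  refine le_max_of_le_right (abs_le.mpr ⟨?_, ?_⟩)
  · have hlog : Real.log (y i) ≤ Real.log (y i / w i) :=
      Real.log_le_log (hy i) (le_div_self (hy i).le hwi (hw.1 i).2)
    linarith [neg_abs_le (Real.log (y i)), abs_log_le i]
  · have hky : y k / w k ≤ p * y k := by
      rw [div_le_iff₀ hwk]
      rw [div_le_iff₀ hp0] at hk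
      nlinarith [hy k]
    have hlog : Real.log (y i / w i) ≤ Real.log p + Real.log (y k) := by
      rw [← Real.log_mul hp0.ne' (hy k).ne']
      exact Real.log_le_log (div_pos (hy i) hwi) (hle.trans hky)
    linarith [le_abs_self (Real.log (y k)), abs_log_le k]
end
end
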